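/- Let R be a commutative Noetherian local ring, M and N finitely generated R-modules, 𝔞 a Cohen-Macaulay ideal in a Gorenstein local ring R (i.e., R/𝔞 is Cohen-Macaulay), m = depth_R(𝔞, R), and n ≥ 1. Assume M = Ω_R^n N is nonzero, m ≥ n, N is locally free on primes 𝔭 with depth(R_𝔭) ≤ n−1, and N is (n+1)-Tor-rigid. Then depth_R(𝔞, M) ≤ m + n. -/

import Mathlib

open CategoryTheory IsLocalRing

section Defs
variable (R : Type) [CommRing R]

/-- vanishing of `Tor_n(M, N)` -/
noncomputable abbrev TorZero [IsNoetherianRing R] (n : ℕ) (M N : ModuleCat.{0} R) : Prop :=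
  Subsingleton (((Tor (ModuleCat.{0} R) n).obj M).obj N)

/-- vanishing of `Ext^n(M, N)` -/
noncomputable abbrev ExtZero (n : ℕ) (M N : ModuleCat.{0} R) : Prop :=
  Subsingleton (((Ext R (ModuleCat.{0} R) n).obj (Opposite.op M)).obj N)

/-- `x` annihilates `Ext^n(M, N)` -/
noncomputable abbrev SMulExtZero (x : R) (n : ℕ) (M N : ModuleCat.{0} R) : Prop :=
  ∀ e : ((Ext R (ModuleCat.{0} R) n).obj (Opposite.op M)).obj N, x • e = 0

/-- `M` is a minimal first syzygy `Ω N` of `N` over the local ring `R`: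
the kernel of a minimal free cover of `N`. -/
def IsSyzygyOf [IsLocalRing R] (N M : ModuleCat.{0} R) : Prop :=
  ∃ (q : ℕ) (g : (Fin q → R) →ₗ[R] N), Function.Surjective g ∧
    (LinearMap.ker g : Submodule R (Fin q → R)) ≤ (maximalIdeal R) • ⊤ ∧
    Nonempty (M ≃ₗ[R] LinearMap.ker g)

/-- `M` is a minimal `n`-th syzygy `Ω^n N` of `N` (with `Ω^0 N = N`). -/
def IsNthSyzygyOf [IsLocalRing R] : ℕ → ModuleCat.{0} R → ModuleCat.{0} R → Prop
  | 0, N, M => Nonempty (M ≃ₗ[R] N)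
  | (n+1), N, M => ∃ K : ModuleCat.{0} R, IsSyzygyOf R N K ∧ IsNthSyzygyOf n K M

/-- `M` and `N` are stably isomorphic (isomorphic up to free direct summands). -/
def StablyIso (M N : ModuleCat.{0} R) : Prop :=
  ∃ p q : ℕ, Nonempty ((↥M × (Fin p → R)) ≃ₗ[R] (↥N × (Fin q → R)))

/-- Tor-rigidity: one vanishing Tor (against any f.g. module) forces all higher ones. -/
noncomputable def TorRigid [IsNoetherianRing R] (M : ModuleCat.{0} R) : Prop :=
  ∀ (N : ModuleCat.{0} R), Module.Finite R N →
    ∀ i : ℕ, 1 ≤ i → TorZero R i M N → ∀ j, i ≤ j → TorZero R j M N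

/-- `n`-Tor-rigidity: `n` consecutive vanishing Tor's force all higher ones. -/
noncomputable def NTorRigid [IsNoetherianRing R] (n : ℕ) (M : ModuleCat.{0} R) : Prop :=
  ∀ (N : ModuleCat.{0} R), Module.Finite R N → ∀ t : ℕ,
    (∀ i, t + 1 ≤ i → i ≤ t + n → TorZero R i M N) → ∀ j, t + 1 ≤ j → TorZero R j M N

/-- the `𝔞`-depth of `M`: `∞` if `𝔞M = M`, otherwise the supremum (= common length) of
maximal `M`-regular sequences contained in `𝔞`. -/
noncomputable def edepth (𝔞 : Ideal R) (M : Type) [AddCommGroup M] [Module R M] : ℕ∞ :=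
  letI := Classical.dec (𝔞 • (⊤ : Submodule R M) = ⊤)
  if 𝔞 • (⊤ : Submodule R M) = ⊤ then ⊤
  else sSup {n : ℕ∞ | ∃ rs : List R, (rs.length : ℕ∞) = n ∧ (∀ r ∈ rs, r ∈ 𝔞) ∧
    RingTheory.Sequence.IsRegular M rs}

/-- `T` is an Auslander transpose of `N`, computed from a minimal free presentation. -/
def IsTransposeOf [IsLocalRing R] (N T : ModuleCat.{0} R) : Prop :=
  ∃ (q p : ℕ) (g : (Fin q → R) →ₗ[R] N) (f : (Fin p → R) →ₗ[R] (Fin q → R)),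
    Function.Surjective g ∧
    LinearMap.range f = LinearMap.ker g ∧
    (LinearMap.ker g : Submodule R (Fin q → R)) ≤ (maximalIdeal R) • ⊤ ∧
    (LinearMap.ker f : Submodule R (Fin p → R)) ≤ (maximalIdeal R) • ⊤ ∧
    Nonempty (T ≃ₗ[R] (Module.Dual R (Fin p → R) ⧸ LinearMap.range f.dualMap))

/-- `depth (R_𝔭)`, the depth of the local ring `R_𝔭`. -/
noncomputable def depthLoc (𝔭 : Ideal R) [𝔭.IsPrime] : ℕ∞ :=
  edepth (Localization.AtPrime 𝔭) (maximalIdeal (Localization.AtPrime 𝔭)) (Localization.AtPrime 𝔭)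

/-- `depth_{R_𝔭} (M_𝔭)`, the depth of the localized module over the localized ring. -/
noncomputable def primeDepth (𝔭 : Ideal R) [𝔭.IsPrime] (M : Type) [AddCommGroup M]
    [Module R M] : ℕ∞ :=
  edepth (Localization.AtPrime 𝔭) (maximalIdeal (Localization.AtPrime 𝔭))
    (LocalizedModule 𝔭.primeCompl M)

/-- A Noetherian local ring is Gorenstein iff `R` has finite injective dimension as an
`R`-module, i.e. `Ext^i(k, R) = 0` for all sufficiently large `i`. -/
noncomputable def IsGorensteinLocal [IsLocalRing R] : Prop :=
  ∃ d : ℕ, ∀ i : ℕ, d < i → ExtZero R i (ModuleCat.of R (R ⧸ maximalIdeal R)) (ModuleCat.of R R)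

/-- An unramified regular local ring: the maximal ideal is generated by `dim R` elements, and
no rational prime that is a nonzero element of the maximal ideal lies in its square. -/
def IsUnramifiedRegularLocal [IsLocalRing R] : Prop :=
  (∃ s : Finset R, Ideal.span (s : Set R) = maximalIdeal R ∧
    (s.card : WithBot ℕ∞) = ringKrullDim R) ∧
  ∀ p : ℕ, p.Prime → (p : R) ≠ 0 → (p : R) ∈ maximalIdeal R → (p : R) ∉ (maximalIdeal R) ^ 2

end Defs

section PartA
open scoped TensorProduct

/-- vanishing of the (derived category) `Ext^i(Y, Z)` -/
def EZ (R : Type) [CommRing R] (Y Z : Type) [AddCommGroup Y] [Module R Y] [AddCommGroup Z]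
    [Module R Z] (i : ℕ) : Prop :=
  Subsingleton (Abelian.Ext.{0} (ModuleCat.of R Y) (ModuleCat.of R Z) i)

variable {R : Type} [CommRing R]
variable {X Y Z W : Type} [AddCommGroup X] [Module R X] [AddCommGroup Y] [Module R Y]
  [AddCommGroup Z] [Module R Z] [AddCommGroup W] [Module R W]

/-- the short complex of an exact pair -/
def sesC (f : X →ₗ[R] Y) (g : Y →ₗ[R] Z) (h : Function.Exact f g) :
    ShortComplex (ModuleCat.{0} R) :=
  ShortComplex.mk (ModuleCat.ofHom f) (ModuleCat.ofHom g) (by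
    ext x; exact h.apply_apply_eq_zero x)

lemma sesC_exact (f : X →ₗ[R] Y) (g : Y →ₗ[R] Z) (h : Function.Exact f g)
    (hf : Function.Injective f) (hg : Function.Surjective g) : (sesC f g h).ShortExact :=
  ModuleCat.shortComplex_shortExact _ h hf hg

lemma EZ_congr (e : X ≃ₗ[R] Y) {i : ℕ} (h : EZ R X W i) : EZ R Y W i := by
  unfold EZ at *
  refine subsingleton_of_forall_eq 0 fun x => ?_
  generalize e.toModuleIso = e' at *
  have h1 : (Abelian.Ext.mk₀ e'.hom).comp x (zero_add i) = 0 := Subsingleton.elim _ _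
  have := congrArg (fun y => (Abelian.Ext.mk₀ e'.inv).comp y (zero_add i)) h1
  simpa using this

lemma EZ_congr_right (e : X ≃ₗ[R] Y) {i : ℕ} (h : EZ R W X i) : EZ R W Y i := by
  unfold EZ at *
  refine subsingleton_of_forall_eq 0 fun x => ?_
  generalize e.toModuleIso = e' at *
  have h1 : x.comp (Abelian.Ext.mk₀ e'.inv) (add_zero i) = 0 := Subsingleton.elim _ _
  have := congrArg (fun y => y.comp (Abelian.Ext.mk₀ e'.hom) (add_zero i)) h1
  simpa using this

lemma EZ_mid (f : X →ₗ[R] Y) (g : Y →ₗ[R] Z) (h : Function.Exact f g)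
    (hf : Function.Injective f) (hg : Function.Surjective g) {i : ℕ}
    (h1 : EZ R X W i) (h3 : EZ R Z W i) : EZ R Y W i := by
  unfold EZ at *
  refine subsingleton_of_forall_eq 0 fun x => ?_
  obtain ⟨y, rfl⟩ := Abelian.Ext.contravariant_sequence_exact₂ (sesC_exact f g h hf hg)
    (ModuleCat.of R W) x (h1.elim _ _)
  have hy : y = 0 := h3.elim _ _
  rw [hy]; simp <;> rfl

lemma EZ_left (f : X →ₗ[R] Y) (g : Y →ₗ[R] Z) (h : Function.Exact f g)
    (hf : Function.Injective f) (hg : Function.Surjective g) {i : ℕ}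
    (h2 : EZ R Y W i) (h3 : EZ R Z W (i+1)) : EZ R X W i := by
  unfold EZ at *
  refine subsingleton_of_forall_eq 0 fun x => ?_
  obtain ⟨y, rfl⟩ := Abelian.Ext.contravariant_sequence_exact₁ (sesC_exact f g h hf hg)
    (ModuleCat.of R W) x (add_comm 1 i) (h3.elim _ _)
  have hy : y = 0 := h2.elim _ _
  rw [hy]; simp <;> rfl

lemma EZ_right (f : X →ₗ[R] Y) (g : Y →ₗ[R] Z) (h : Function.Exact f g)
    (hf : Function.Injective f) (hg : Function.Surjective g) {i : ℕ}
    (h1 : EZ R X W i) (h2 : EZ R Y W (i+1)) : EZ R Z W (i+1) := by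
  unfold EZ at *
  refine subsingleton_of_forall_eq 0 fun x => ?_
  obtain ⟨y, rfl⟩ := Abelian.Ext.contravariant_sequence_exact₃ (sesC_exact f g h hf hg)
    (ModuleCat.of R W) x (h2.elim _ _) (add_comm 1 i)
  have hy : y = 0 := h1.elim _ _
  rw [hy]; simp <;> rfl

lemma EZ_cov_right (f : X →ₗ[R] Y) (g : Y →ₗ[R] Z) (h : Function.Exact f g)
    (hf : Function.Injective f) (hg : Function.Surjective g) {i : ℕ}
    (h1 : EZ R W Y i) (h2 : EZ R W X (i+1)) : EZ R W Z i := by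
  unfold EZ at *
  refine subsingleton_of_forall_eq 0 fun x => ?_
  obtain ⟨y, rfl⟩ := Abelian.Ext.covariant_sequence_exact₃ (ModuleCat.of R W)
    (sesC_exact f g h hf hg) x rfl (h2.elim _ _)
  have hy : y = 0 := h1.elim _ _
  rw [hy]; simp <;> rfl

lemma EZ_zero_iff : EZ R X Y 0 ↔ Subsingleton (X →ₗ[R] Y) :=
  ((Abelian.Ext.linearEquiv₀ (R := R) (X := ModuleCat.of R X) (Y := ModuleCat.of R Y)).trans
    ModuleCat.homLinearEquiv).toEquiv.subsingleton_congr

/-- Nakayama on `Ext`. -/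
lemma EZ_nakayama [IsNoetherianRing R] [IsLocalRing R] [Module.Finite R X] [Module.Finite R W]
    {x : R} (hx : x ∈ maximalIdeal R) (hreg : IsSMulRegular X x) {i : ℕ}
    (h : EZ R (QuotSMulTop x X) W (i+1)) : EZ R X W i := by
  unfold EZ at *
  have hS := IsSMulRegular.smulShortComplex_shortExact (M := ModuleCat.of R X) hreg
  have key : ∀ e : Abelian.Ext.{0} (ModuleCat.of R X) (ModuleCat.of R W) i, ∃ e', x • e' = e := by
    intro e
    obtain ⟨y, hy⟩ := Abelian.Ext.contravariant_sequence_exact₁ hS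
      (ModuleCat.of R W) e (add_comm 1 i) (h.elim _ _)
    refine ⟨y, ?_⟩
    rw [← hy, ModuleCat.smulShortComplex_f_eq_smul_id]
    change Abelian.Ext.{0} (ModuleCat.of R X) (ModuleCat.of R W) i at y
    change x • y = (Abelian.Ext.mk₀ (x • 𝟙 (ModuleCat.of R X))).comp y _
    rw [Abelian.Ext.mk₀_smul, Abelian.Ext.smul_comp, Abelian.Ext.mk₀_id_comp]
  have hfin : Module.Finite R (Abelian.Ext.{0} (ModuleCat.of R X) (ModuleCat.of R W) i) :=
    inferInstance
  by_contra hne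
  rw [not_subsingleton_iff_nontrivial] at hne
  have := nontrivial_quotSMulTop_of_mem_maximalIdeal
    (Abelian.Ext.{0} (ModuleCat.of R X) (ModuleCat.of R W) i) hx
  rw [Submodule.Quotient.nontrivial_iff] at this
  apply this
  rw [eq_top_iff]
  intro e _
  obtain ⟨e', rfl⟩ := key e
  exact Submodule.smul_mem_pointwise_smul _ _ _ trivial

lemma EZ_rees_up {x : R} (hx : x ∈ Module.annihilator R W) (hreg : IsSMulRegular X x) {i : ℕ}
    (h : EZ R W (QuotSMulTop x X) i) : EZ R W X (i+1) := by
  unfold EZ at *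
  have hS := IsSMulRegular.smulShortComplex_shortExact (M := ModuleCat.of R X) hreg
  refine subsingleton_of_forall_eq 0 fun e => ?_
  obtain ⟨y, hy⟩ := Abelian.Ext.covariant_sequence_exact₁ (ModuleCat.of R W) hS e (by
      have := Abelian.Ext.postcomp_smul_id_eq_zero_of_mem_annihilator (M := ModuleCat.of R X)
        (N := ModuleCat.of R W) hx (i+1)
      exact congrArg (fun f => f.hom e) this) rfl
  have hy0 : y = 0 := h.elim _ _
  rw [← hy, hy0]; simp <;> rfl

open Pointwise in
lemma EZ_rees_down {x : R} (hreg : IsSMulRegular X x) {i : ℕ}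
    (h : EZ R W X i) (h' : EZ R W X (i+1)) : EZ R W (QuotSMulTop x X) i :=
  EZ_cov_right (LinearMap.lsmul R X x) (x • (⊤ : Submodule R X)).mkQ
    (LinearMap.exact_lsmul_mkQ_smul_top X x) hreg (Submodule.mkQ_surjective _) h h'

open RingTheory.Sequence in
lemma EZ_of_regular (rs : List R) : ∀ (X : Type) [AddCommGroup X] [Module R X],
    IsWeaklyRegular X rs → (∀ r ∈ rs, r ∈ Module.annihilator R W) → ∀ i < rs.length,
    EZ R W X i := by
  induction rs with
  | nil => intro X _ _ _ _ i hi; simp at hi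
  | cons r rs ih =>
    intro X _ _ hreg hmem i hi
    rw [isWeaklyRegular_cons_iff] at hreg
    rcases i with _ | i
    · rw [EZ_zero_iff]
      exact IsSMulRegular.linearMap_subsingleton_of_mem_annihilator hreg.1 (hmem r (by simp))
    · apply EZ_rees_up (hmem r (by simp)) hreg.1
      exact ih _ hreg.2 (fun r hr => hmem r (by simp [hr])) i (by simpa using hi)

open RingTheory.Sequence in
lemma exists_regular_of_EZ [IsNoetherianRing R] [Module.Finite R W] (k : ℕ) :
    ∀ (X : Type) [AddCommGroup X] [Module R X] [Module.Finite R X],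
    (∀ i < k, EZ R W X i) → ∃ rs : List R, rs.length = k ∧ IsWeaklyRegular X rs ∧
      (∀ r ∈ rs, r ∈ Module.annihilator R W) := by
  induction k with
  | zero => intro X _ _ _ _; exact ⟨[], rfl, by simp, by simp⟩
  | succ k ih =>
    intro X _ _ _ h
    obtain ⟨r, hr, hreg⟩ := IsSMulRegular.subsingleton_linearMap_iff.mp
      (EZ_zero_iff.mp (h 0 (by omega)))
    obtain ⟨rs, hl, hw, hm⟩ := ih (QuotSMulTop r X)
      (fun i hi => EZ_rees_down hreg (h i (by omega)) (h (i+1) (by omega)))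
    refine ⟨r :: rs, by simp [hl], (isWeaklyRegular_cons_iff _ _ _).2 ⟨hreg, hw⟩, ?_⟩
    intro a ha
    rcases List.mem_cons.1 ha with rfl | ha
    · exact hr
    · exact hm a ha

lemma devissage [IsNoetherianRing R] [hY : Module.Finite R Y] (i : ℕ)
    (h : ∀ q ∈ Module.support R Y, EZ R (R ⧸ q.asIdeal) W i) : EZ R Y W i := by
  revert h
  refine IsNoetherianRing.induction_on_isQuotientEquivQuotientPrime (A := R) (M := Y) hY
    (motive := fun N _ _ _ => (∀ q ∈ Module.support R N, EZ R (R ⧸ q.asIdeal) W i) → EZ R N W i)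
    ?_ ?_ ?_
  · intro N _ _ _ _ _
    unfold EZ
    refine subsingleton_of_forall_eq 0 fun x => ?_
    have h0 : (𝟙 (ModuleCat.of R N)) = 0 :=
      (ModuleCat.isZero_of_subsingleton (ModuleCat.of R N)).eq_of_src _ _
    have := Abelian.Ext.mk₀_id_comp x
    rw [h0] at this
    simpa using this.symm
  · intro N _ _ _ p e h
    refine EZ_congr e.symm (h p ?_)
    rw [Module.mem_support_iff_of_finite, e.annihilator_eq, Ideal.annihilator_quotient]
  · intro N₁ _ _ _ N₂ _ _ _ N₃ _ _ _ f g hf hg hfg h1 h3 h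
    rw [Module.support_of_exact hfg hf hg] at h
    exact EZ_mid f g hfg hf hg (h1 fun q hq => h q (Or.inl hq)) (h3 fun q hq => h q (Or.inr hq))

lemma regular_quot_prime (p : Ideal R) [p.IsPrime] {x : R} (hx : x ∉ p) :
    IsSMulRegular (R ⧸ p) x := by
  rw [isSMulRegular_iff_right_eq_zero_of_smul]
  intro y hy
  rw [Algebra.smul_def] at hy
  rcases mul_eq_zero.1 hy with h | h
  · exact absurd (Ideal.Quotient.eq_zero_iff_mem.1 h) hx
  · exact h

lemma support_quot_prime [IsNoetherianRing R] (p : Ideal R) (x : R) (q : PrimeSpectrum R)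
    (hq : q ∈ Module.support R (QuotSMulTop x (R ⧸ p))) : p ≤ q.asIdeal ∧ x ∈ q.asIdeal := by
  rw [Module.mem_support_iff_of_finite] at hq
  constructor
  · intro a ha
    apply hq
    rw [Module.mem_annihilator]
    intro y
    obtain ⟨y, rfl⟩ := Submodule.mkQ_surjective _ y
    rw [← map_smul]
    have : a • y = 0 := by
      rw [Algebra.smul_def]
      rw [show algebraMap R (R ⧸ p) a = 0 from Ideal.Quotient.eq_zero_iff_mem.2 ha, zero_mul]
    rw [this, map_zero]
  · apply hq
    rw [Module.mem_annihilator]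
    intro y
    obtain ⟨y, rfl⟩ := Submodule.mkQ_surjective _ y
    rw [← map_smul]
    simp only [Submodule.mkQ_apply, Submodule.Quotient.mk_eq_zero]
    exact Submodule.smul_mem_pointwise_smul _ _ _ trivial

variable [IsNoetherianRing R] [IsLocalRing R]

lemma exists_notMem_prime (p : Ideal R) [p.IsPrime] (hp : p ≠ maximalIdeal R) :
    ∃ x ∈ maximalIdeal R, x ∉ p := by
  have : p < maximalIdeal R := lt_of_le_of_ne (le_maximalIdeal (Ideal.IsPrime.ne_top')) hp
  exact SetLike.exists_of_lt this

/-- high vanishing against the residue field gives high vanishing for all f.g. modules -/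
lemma EZ_high [Module.Finite R W] (d : ℕ) (h : ∀ i, d ≤ i → EZ R (R ⧸ maximalIdeal R) W i)
    [Module.Finite R Y] (i : ℕ) (hi : d ≤ i) : EZ R Y W i := by
  have key : ∀ p : Ideal R, p.IsPrime → ∀ i, d ≤ i → EZ R (R ⧸ p) W i := by
    intro p
    induction p using WellFoundedGT.induction with
    | ind p ih =>
      intro hp i hi
      by_cases hpm : p = maximalIdeal R
      · rw [hpm]; exact h i hi
      · obtain ⟨x, hx, hxp⟩ := exists_notMem_prime p hpm
        apply EZ_nakayama hx (regular_quot_prime p hxp)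
        apply devissage
        intro q hq
        obtain ⟨h1, h2⟩ := support_quot_prime p x q hq
        exact ih _ (lt_of_le_of_ne h1 (fun h => hxp (h ▸ h2))) q.2 _ (by omega)
  exact devissage i fun q _ => key _ q.2 i hi

lemma EZ_low [Module.Finite R W] (s : ℕ) (h : ∀ i, i < s → EZ R (R ⧸ maximalIdeal R) W i) (r : ℕ) :
    ∀ (p : Ideal R), p.IsPrime → ringKrullDim (R ⧸ p) ≤ r → ∀ i, i + r < s →
      EZ R (R ⧸ p) W i := by
  induction r with
  | zero =>
    intro p hp hd i hi
    by_cases hpm : p = maximalIdeal R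
    · rw [hpm]; exact h i (by omega)
    · exfalso
      obtain ⟨x, hx, hxp⟩ := exists_notMem_prime p hpm
      have := ringKrullDim_succ_le_of_surjective
        (Ideal.Quotient.factor (le_maximalIdeal hp.ne_top)) (Ideal.Quotient.factor_surjective _)
        (r := Ideal.Quotient.mk p x) (by
          rw [mem_nonZeroDivisors_iff_ne_zero]
          simpa [Ideal.Quotient.eq_zero_iff_mem] using hxp)
        (by simpa [Ideal.Quotient.eq_zero_iff_mem] using hx)
      have h0 : (0 : WithBot ℕ∞) ≤ ringKrullDim (R ⧸ maximalIdeal R) := ringKrullDim_nonneg_of_nontrivial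
      have : (1 : WithBot ℕ∞) ≤ 0 := by
        calc (1 : WithBot ℕ∞) = 0 + 1 := by simp
          _ ≤ ringKrullDim (R ⧸ maximalIdeal R) + 1 := by gcongr
          _ ≤ _ := this
          _ ≤ 0 := by simpa using hd
      exact absurd this (by decide)
  | succ r ih =>
    intro p hp hd i hi
    by_cases hpm : p = maximalIdeal R
    · rw [hpm]; exact h i (by omega)
    · obtain ⟨x, hx, hxp⟩ := exists_notMem_prime p hpm
      apply EZ_nakayama hx (regular_quot_prime p hxp)
      apply devissage
      intro q hq
      obtain ⟨h1, h2⟩ := support_quot_prime p x q hq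
      refine ih _ q.2 ?_ _ (by omega)
      have := ringKrullDim_succ_le_of_surjective
        (Ideal.Quotient.factor h1) (Ideal.Quotient.factor_surjective _)
        (r := Ideal.Quotient.mk p x) (by
          rw [mem_nonZeroDivisors_iff_ne_zero]
          simpa [Ideal.Quotient.eq_zero_iff_mem] using hxp)
        (by simpa [Ideal.Quotient.eq_zero_iff_mem] using h2)
      have := this.trans hd
      push_cast at this
      exact (ENat.WithBot.add_le_add_one_right_iff).1 this

lemma EZ_low_ideal [Module.Finite R W] (s : ℕ)
    (h : ∀ i, i < s → EZ R (R ⧸ maximalIdeal R) W i) (r : ℕ)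
    (a : Ideal R) (hd : ringKrullDim (R ⧸ a) ≤ r) (i : ℕ) (hi : i + r < s) :
    EZ R (R ⧸ a) W i := by
  apply devissage
  intro q hq
  rw [Module.mem_support_iff_of_finite, Ideal.annihilator_quotient] at hq
  exact EZ_low s h r _ q.2 ((ringKrullDim_le_of_surjective (Ideal.Quotient.factor hq)
    (Ideal.Quotient.factor_surjective _)).trans hd) i hi

open RingTheory.Sequence in
lemma EZ_depth [Module.Finite R W] (s : ℕ)
    (h : ∀ (Y : Type) [AddCommGroup Y] [Module R Y] [Module.Finite R Y], ∀ i, s < i → EZ R Y W i)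
    (rs : List R) : ∀ (X : Type) [AddCommGroup X] [Module R X] [Module.Finite R X],
    IsWeaklyRegular X rs → (∀ r ∈ rs, r ∈ maximalIdeal R) → ∀ i, s < i + rs.length →
    EZ R X W i := by
  induction rs with
  | nil => intro X _ _ _ _ _ i hi; exact h X i (by simpa using hi)
  | cons r rs ih =>
    intro X _ _ _ hreg hmem i hi
    rw [isWeaklyRegular_cons_iff] at hreg
    apply EZ_nakayama (hmem r (by simp)) hreg.1
    exact ih _ hreg.2 (fun r hr => hmem r (by simp [hr])) (i+1) (by simp at hi; omega)

open RingTheory.Sequence in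
lemma EZ_pd (rs : List R) (reg : IsWeaklyRegular R rs) (mem : ∀ r ∈ rs, r ∈ maximalIdeal R)
    (i : ℕ) (hi : rs.length < i) : EZ R (R ⧸ Ideal.ofList rs • (⊤ : Submodule R R)) W i := by
  have h := ModuleCat.projectiveDimension_quotient_eq_add_length_of_isWeaklyRegular
    (ModuleCat.of R R) rs reg mem
  rw [ModuleCat.projectiveDimension_eq_zero_of_projective (ModuleCat.of R R), zero_add] at h
  have h2 : HasProjectiveDimensionLE
      (ModuleCat.of R (R ⧸ Ideal.ofList rs • (⊤ : Submodule R R))) rs.length := by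
    rw [← projectiveDimension_le_iff]
    exact h.le
  exact HasProjectiveDimensionLT.subsingleton _ (rs.length + 1) i (by omega) _

open RingTheory.Sequence in
/-- the injective dimension of a Gorenstein local ring equals its depth -/
lemma gorenstein_ext (hG : ∃ d : ℕ, ∀ i, d < i → EZ R (R ⧸ maximalIdeal R) R i) :
    ∃ s : ℕ, (∀ i, i < s → EZ R (R ⧸ maximalIdeal R) R i) ∧
      ∀ (Y : Type) [AddCommGroup Y] [Module R Y] [Module.Finite R Y], ∀ i, s < i → EZ R Y R i := by
  classical
  obtain ⟨d, hd⟩ := hG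
  have hex : ∃ i, ¬ EZ R (R ⧸ maximalIdeal R) R i := by
    by_contra hcon
    push Not at hcon
    have := EZ_high (Y := R) (W := R) 0 (fun i _ => hcon i) 0 le_rfl
    rw [EZ_zero_iff] at this
    have h1 := congrArg (fun f : R →ₗ[R] R => f 1) (this.elim LinearMap.id 0)
    simp at h1
  let s := Nat.find hex
  have hs : ∀ i < s, EZ R (R ⧸ maximalIdeal R) R i := fun i hi => not_not.1 (Nat.find_min hex hi)
  refine ⟨s, hs, ?_⟩
  obtain ⟨rs, hl, hw, hm⟩ := exists_regular_of_EZ s R hs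
  have hm' : ∀ r ∈ rs, r ∈ maximalIdeal R := by
    intro r hr
    have := hm r hr
    rwa [Ideal.annihilator_quotient] at this
  have hne : ¬ Subsingleton ((R ⧸ maximalIdeal R) →ₗ[R]
      (R ⧸ Ideal.ofList rs • (⊤ : Submodule R R))) := by
    intro hsub
    obtain ⟨r, hr, hreg⟩ := IsSMulRegular.subsingleton_linearMap_iff.mp hsub
    have hw2 : IsWeaklyRegular R (rs ++ [r]) := by
      rw [isWeaklyRegular_append_iff]
      exact ⟨hw, (isWeaklyRegular_singleton_iff _ r).2 hreg⟩
    refine Nat.find_spec hex (EZ_of_regular (rs ++ [r]) R hw2 ?_ s (by simp [hl]))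
    intro a ha
    rcases List.mem_append.1 ha with ha | ha
    · exact hm a ha
    · rw [List.mem_singleton.1 ha]; exact hr
  rw [not_subsingleton_iff_nontrivial] at hne
  obtain ⟨f, hf⟩ := exists_ne (0 : (R ⧸ maximalIdeal R) →ₗ[R]
      (R ⧸ Ideal.ofList rs • (⊤ : Submodule R R)))
  have hsimp : IsSimpleModule R (R ⧸ maximalIdeal R) :=
    (isSimpleModule_iff_quot_maximal).2 ⟨maximalIdeal R, inferInstance, ⟨LinearEquiv.refl _ _⟩⟩
  have hinj := LinearMap.injective_of_ne_zero hf
  have key : ∀ c : ℕ, ∀ i, s < i → d < i + c → EZ R (R ⧸ maximalIdeal R) R i := by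
    intro c
    induction c with
    | zero => intro i _ hi; exact hd i hi
    | succ c ih =>
      intro i hsi hi
      refine EZ_left f (LinearMap.range f).mkQ (LinearMap.exact_map_mkQ_range f) hinj
        (Submodule.mkQ_surjective _) (EZ_pd rs hw hm' i (by omega)) ?_
      exact EZ_high (i+1) (fun j hj => ih j (by omega) (by omega)) (i+1) le_rfl
  intro Y _ _ _ i hi
  exact EZ_high (s+1) (fun j hj => key (d+1) j (by omega) (by omega)) i (by omega)

open RingTheory.Sequence in
/-- `Ext^i(R/𝔞, R)` is concentrated in degree `m = grade 𝔞` -/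
lemma ext_concentrated (hG : ∃ d : ℕ, ∀ i, d < i → EZ R (R ⧸ maximalIdeal R) R i)
    (a : Ideal R) (t : ℕ) (hdim : ringKrullDim (R ⧸ a) ≤ t)
    (rs : List R) (hrs : IsWeaklyRegular (R ⧸ a) rs) (hrsm : ∀ r ∈ rs, r ∈ maximalIdeal R)
    (hlen : rs.length = t) (m : ℕ)
    (hm : ∃ ys : List R, ys.length = m ∧ IsWeaklyRegular R ys ∧ ∀ r ∈ ys, r ∈ a)
    (hm' : ¬ ∃ ys : List R, ys.length = m + 1 ∧ IsWeaklyRegular R ys ∧ ∀ r ∈ ys, r ∈ a) :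
    ¬ EZ R (R ⧸ a) R m ∧ ∀ i, m < i → EZ R (R ⧸ a) R i := by
  obtain ⟨s, hs1, hs2⟩ := gorenstein_ext hG
  have hlow : ∀ i < m, EZ R (R ⧸ a) R i := by
    obtain ⟨ys, hl, hw, hy⟩ := hm
    intro i hi
    exact EZ_of_regular ys R hw (fun r hr => by rw [Ideal.annihilator_quotient]; exact hy r hr) i
      (by omega)
  have hnot : ¬ ∀ i < m + 1, EZ R (R ⧸ a) R i := by
    intro h
    obtain ⟨ys, hl, hw, hy⟩ := exists_regular_of_EZ (m+1) R h
    exact hm' ⟨ys, hl, hw, fun r hr => by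
      have := hy r hr
      rwa [Ideal.annihilator_quotient] at this⟩
  refine ⟨fun h => hnot fun i hi => ?_, fun i hi => ?_⟩
  · rcases Nat.lt_succ_iff_lt_or_eq.1 hi with h' | rfl
    · exact hlow i h'
    · exact h
  · refine EZ_depth s hs2 rs _ hrs hrsm i ?_
    by_contra hcon
    exact hnot fun j hj => EZ_low_ideal s hs1 t a hdim j (by omega)

end PartA

section PartA2
open scoped TensorProduct
lemma EZ_of_ExtZero {R : Type} [CommRing R] (Y Z : Type) [AddCommGroup Y] [Module R Y]
    [AddCommGroup Z] [Module R Z] (j : ℕ)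
    (h : Subsingleton (((Ext R (ModuleCat.{0} R) (j+1)).obj
      (Opposite.op (ModuleCat.of R Y))).obj (ModuleCat.of R Z))) : EZ R Y Z (j+1) := by
  let P := projectiveResolution (ModuleCat.of R Y)
  have h0 := (ModuleCat.isZero_of_subsingleton _).of_iso
    (P.isoExt (R := R) (j+1) (ModuleCat.of R Z)).symm
  rw [← HomologicalComplex.exactAt_iff_isZero_homology,
    HomologicalComplex.exactAt_iff' _ j (j+1) (j+2) (by simp) (by simp),
    ShortComplex.moduleCat_exact_iff] at h0
  unfold EZ
  refine subsingleton_of_forall_eq 0 fun x => ?_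
  obtain ⟨f, hf, rfl⟩ := P.extMk_surjective x (j+2) rfl
  rw [P.extMk_eq_zero_iff f (j+2) rfl hf j rfl]
  obtain ⟨g, hg⟩ := h0 f hf
  exact ⟨g, hg⟩
end PartA2

section PartB
open scoped TensorProduct

lemma chase33 {R A B C D E G H I : Type} [CommRing R]
    [AddCommGroup A] [AddCommGroup B] [AddCommGroup C] [AddCommGroup D] [AddCommGroup E]
    [AddCommGroup G] [AddCommGroup H] [AddCommGroup I]
    [Module R A] [Module R B] [Module R C] [Module R D] [Module R E]
    [Module R G] [Module R H] [Module R I]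
    (a : A →ₗ[R] B) (b : B →ₗ[R] C) (d : D →ₗ[R] E) (e : E →ₗ[R] G)
    (v1 : A →ₗ[R] D) (v2 : B →ₗ[R] E) (v3 : C →ₗ[R] G)
    (w1 : D →ₗ[R] H) (w2 : E →ₗ[R] I) (h : H →ₗ[R] I)
    (c1 : ∀ x, v2 (a x) = d (v1 x)) (c2 : ∀ x, v3 (b x) = e (v2 x))
    (c3 : ∀ x, w2 (d x) = h (w1 x))
    (hb : Function.Surjective b) (hde : Function.Exact d e) (hvw : Function.Exact v1 w1)
    (hwv : ∀ x, w2 (v2 x) = 0) (hba : ∀ x, b (a x) = 0) (hv2 : Function.Injective v2)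
    (hh : Function.Injective h) : Function.Injective v3 := by
  rw [injective_iff_map_eq_zero]
  intro x hx
  obtain ⟨y, rfl⟩ := hb x
  rw [c2] at hx
  obtain ⟨z, hz⟩ := (hde _).1 hx
  have h1 : w1 z = 0 := by
    apply hh
    rw [← c3, hz, hwv, map_zero]
  obtain ⟨w, rfl⟩ := (hvw _).1 h1
  have : a w = y := hv2 (by rw [c1, hz])
  rw [← this, hba]

variable {R : Type} [CommRing R]

/-- balancing of the first Tor -/
lemma balance {N' F N K P Y : Type} [AddCommGroup N'] [AddCommGroup F] [AddCommGroup N]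
    [AddCommGroup K] [AddCommGroup P] [AddCommGroup Y] [Module R N'] [Module R F] [Module R N]
    [Module R K] [Module R P] [Module R Y] [Module.Flat R F] [Module.Flat R P]
    (f : N' →ₗ[R] F) (g : F →ₗ[R] N) (hf : Function.Injective f) (hg : Function.Surjective g)
    (hfg : Function.Exact f g)
    (i : K →ₗ[R] P) (p : P →ₗ[R] Y) (hi : Function.Injective i) (hp : Function.Surjective p)
    (hip : Function.Exact i p) :
    Function.Injective (i.lTensor N) ↔ Function.Injective (f.rTensor Y) := by
  constructor
  · refine chase33 (i.lTensor N') (p.lTensor N') (i.lTensor F) (p.lTensor F)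
      (f.rTensor K) (f.rTensor P) (f.rTensor Y) (g.rTensor K) (g.rTensor P) (i.lTensor N)
      ?_ ?_ ?_ ?_ ?_ ?_ ?_ ?_ ?_
    · intro x; simp [← LinearMap.comp_apply]
    · intro x; simp [← LinearMap.comp_apply]
    · intro x; simp [← LinearMap.comp_apply]
    · exact LinearMap.lTensor_surjective _ hp
    · exact lTensor_exact _ hip hp
    · exact rTensor_exact _ hfg hg
    · exact fun x => (rTensor_exact P hfg hg).apply_apply_eq_zero x
    · exact fun x => (lTensor_exact N' hip hp).apply_apply_eq_zero x
    · exact Module.Flat.rTensor_preserves_injective_linearMap f hf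
  · refine chase33 (f.rTensor K) (g.rTensor K) (f.rTensor P) (g.rTensor P)
      (i.lTensor N') (i.lTensor F) (i.lTensor N) (p.lTensor N') (p.lTensor F) (f.rTensor Y)
      ?_ ?_ ?_ ?_ ?_ ?_ ?_ ?_ ?_
    · intro x; simp [← LinearMap.comp_apply]
    · intro x; simp [← LinearMap.comp_apply]
    · intro x; simp [← LinearMap.comp_apply]
    · exact LinearMap.rTensor_surjective _ hg
    · exact rTensor_exact _ hfg hg
    · exact lTensor_exact _ hip hp
    · exact fun x => (lTensor_exact F hip hp).apply_apply_eq_zero x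
    · exact fun x => (rTensor_exact K hfg hg).apply_apply_eq_zero x
    · exact Module.Flat.lTensor_preserves_injective_linearMap i hi

variable [IsNoetherianRing R]

lemma TorZero_iff_res (N Y : ModuleCat.{0} R) (P : ProjectiveResolution Y) (i : ℕ) :
    TorZero R (i+1) N Y ↔
      Function.Exact ((P.complex.d (i+2) (i+1)).hom.lTensor N)
        ((P.complex.d (i+1) i).hom.lTensor N) := by
  have e := P.isoLeftDerivedObj ((MonoidalCategory.tensoringLeft (ModuleCat.{0} R)).obj N) (i+1)
  have : TorZero R (i+1) N Y ↔ Limits.IsZero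
     (((((MonoidalCategory.tensoringLeft (ModuleCat.{0} R)).obj N).mapHomologicalComplex _).obj
      P.complex).homology (i+1)) := by
    rw [TorZero, ← ModuleCat.isZero_iff_subsingleton]
    exact e.isZero_iff
  rw [this, ← HomologicalComplex.exactAt_iff_isZero_homology,
    HomologicalComplex.exactAt_iff' _ (i+2) (i+1) i (by simp) (by simp),
    ShortComplex.ShortExact.moduleCat_exact_iff_function_exact]
  rfl

end PartB

section PartB2
open scoped TensorProduct
variable {R : Type} [CommRing R]

/-- the augmentation, retyped -/
noncomputable def pi0 {K : ModuleCat.{0} R} (Q : ProjectiveResolution K) : Q.complex.X 0 ⟶ K :=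
  Q.π.f 0

lemma d_pi0 {K : ModuleCat.{0} R} (Q : ProjectiveResolution K) :
    Q.complex.d 1 0 ≫ pi0 Q = 0 := Q.complex_d_comp_π_f_zero

lemma aug_w {K P : ModuleCat.{0} R} (Q : ProjectiveResolution K) (i : K ⟶ P) :
    Q.complex.d 1 0 ≫ (pi0 Q ≫ i) = 0 := by
  rw [← Category.assoc, d_pi0, Limits.zero_comp]

/-- the augmented complex -/
noncomputable def augC {K P : ModuleCat.{0} R} (Q : ProjectiveResolution K) (i : K ⟶ P) :
    ChainComplex (ModuleCat.{0} R) ℕ :=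
  ChainComplex.augment Q.complex (pi0 Q ≫ i) (aug_w Q i)

lemma res_surj {K : ModuleCat.{0} R} (Q : ProjectiveResolution K) :
    Function.Surjective (pi0 Q).hom :=
  (ModuleCat.epi_iff_surjective (Q.π.f 0)).1 inferInstance

lemma augC_exactAt {K P : ModuleCat.{0} R} (Q : ProjectiveResolution K) (i : K ⟶ P)
    (hi : Function.Injective i) (n : ℕ) : (augC Q i).ExactAt (n + 1) := by
  rw [HomologicalComplex.exactAt_iff' _ (n+2) (n+1) n (by simp) (by simp)]
  rcases n with _ | n
  · have := Q.exact₀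
    rw [ShortComplex.ShortExact.moduleCat_exact_iff_function_exact] at this ⊢
    intro x
    refine Iff.trans ?_ (this x)
    change i (pi0 Q x) = 0 ↔ pi0 Q x = 0
    exact (map_eq_zero_iff i.hom hi)
  · exact Q.exact_succ n

/-- the augmented resolution -/
noncomputable def augRes {K P Y : ModuleCat.{0} R} (Q : ProjectiveResolution K) (i : K ⟶ P) (p : P ⟶ Y)
    [Projective P] (hi : Function.Injective i) (hp : Function.Surjective p)
    (hip : Function.Exact i p) : ProjectiveResolution Y where
  complex := augC Q i
  projective n := by
    rcases n with _ | n
    · exact (inferInstance : Projective P)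
    · exact Q.projective n
  π := (ChainComplex.toSingle₀Equiv _ _).symm ⟨p, by
    have : i ≫ p = 0 := by ext x; exact hip.apply_apply_eq_zero x
    change (pi0 Q ≫ i) ≫ p = 0
    rw [Category.assoc, this, Limits.comp_zero]⟩
  quasiIso := ⟨fun n => by
    cases n
    · rw [ChainComplex.quasiIsoAt₀_iff, ShortComplex.quasiIso_iff_of_zeros']
      · have hw : (pi0 Q ≫ i) ≫ p = 0 := by
          have : i ≫ p = 0 := by ext x; exact hip.apply_apply_eq_zero x
          rw [Category.assoc, this, Limits.comp_zero]
        refine (ShortComplex.exact_and_epi_g_iff_of_iso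
          (S₂ := ShortComplex.mk (pi0 Q ≫ i) p hw) ?_).2
          ⟨?_, (ModuleCat.epi_iff_surjective _).2 hp⟩
        · exact ShortComplex.isoMk (Iso.refl _) (Iso.refl _) (Iso.refl _)
            (by simp; rfl) (by simp; rfl)
        · rw [ShortComplex.ShortExact.moduleCat_exact_iff_function_exact]
          intro x
          refine (hip x).trans ?_
          constructor
          · rintro ⟨y, rfl⟩
            obtain ⟨z, rfl⟩ := res_surj Q y
            exact ⟨z, rfl⟩
          · rintro ⟨y, rfl⟩
            exact ⟨pi0 Q y, rfl⟩
      all_goals rfl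
    · rw [quasiIsoAt_iff_exactAt']
      · exact augC_exactAt Q i hi _
      · apply ChainComplex.exactAt_succ_single_obj⟩

variable [IsNoetherianRing R]
variable {K P Y : Type} [AddCommGroup K] [AddCommGroup P] [AddCommGroup Y] 
  [Module R K] [Module R P] [Module R Y]

/-- vanishing of Tor, unbundled -/
def TZ (R : Type) [CommRing R] [IsNoetherianRing R] (n : ℕ) (N Y : Type) [AddCommGroup N]
    [Module R N] [AddCommGroup Y] [Module R Y] : Prop :=
  TorZero R n (ModuleCat.of R N) (ModuleCat.of R Y)

lemma TZ_two (N : Type) [AddCommGroup N] [Module R N]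
    (i : K →ₗ[R] P) (p : P →ₗ[R] Y) [Module.Projective R P]
    (hi : Function.Injective i) (hp : Function.Surjective p) (hip : Function.Exact i p) (j : ℕ) :
    TZ R (j+2) N Y ↔ TZ R (j+1) N K := by
  let Q := projectiveResolution (ModuleCat.of R K)
  have : Projective (ModuleCat.of R P) := (IsProjective.iff_projective P).1 inferInstance
  unfold TZ
  rw [TorZero_iff_res _ _ (augRes Q (ModuleCat.ofHom i) (ModuleCat.ofHom p) hi hp hip),
    TorZero_iff_res _ _ Q]
  rfl

lemma TZ_one (N : Type) [AddCommGroup N] [Module R N]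
    (i : K →ₗ[R] P) (p : P →ₗ[R] Y) [Module.Projective R P]
    (hi : Function.Injective i) (hp : Function.Surjective p) (hip : Function.Exact i p) :
    TZ R 1 N Y ↔ Function.Injective (i.lTensor N) := by
  let Q := projectiveResolution (ModuleCat.of R K)
  have : Projective (ModuleCat.of R P) := (IsProjective.iff_projective P).1 inferInstance
  let q : Q.complex.X 0 →ₗ[R] K := (pi0 Q).hom
  unfold TZ
  rw [TorZero_iff_res _ _ (augRes Q (ModuleCat.ofHom i) (ModuleCat.ofHom p) hi hp hip)]
  change Function.Exact ((Q.complex.d 1 0).hom.lTensor N)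
    ((i ∘ₗ q).lTensor N) ↔ _
  have hex : Function.Exact (Q.complex.d 1 0).hom q :=
    (ShortComplex.ShortExact.moduleCat_exact_iff_function_exact _).1 Q.exact₀
  have hqs : Function.Surjective q := res_surj Q
  have hex2 := lTensor_exact N hex hqs
  have hs := LinearMap.lTensor_surjective N hqs
  rw [LinearMap.lTensor_comp]
  constructor
  · intro h
    rw [injective_iff_map_eq_zero]
    intro x hx
    obtain ⟨y, rfl⟩ := hs x
    exact (hex2 y).2 ((h y).1 hx)
  · intro h y
    rw [← hex2 y]
    exact map_eq_zero_iff (i.lTensor N) h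

end PartB2

section PartB3
open scoped TensorProduct
variable {R : Type} [CommRing R]

lemma inj_swap {N' F K P : Type} [AddCommGroup N'] [AddCommGroup F]
    [AddCommGroup K] [AddCommGroup P] [Module R N'] [Module R F]
    [Module R K] [Module R P] [Module.Flat R F] [Module.Flat R P]
    (f : N' →ₗ[R] F) (hf : Function.Injective f)
    (i : K →ₗ[R] P) (hi : Function.Injective i) :
    Function.Injective (i.lTensor N') ↔ Function.Injective (f.rTensor K) := by
  have h1 : Function.Injective (f.rTensor P) :=
    Module.Flat.rTensor_preserves_injective_linearMap f hf
  have h2 : Function.Injective (i.lTensor F) :=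
    Module.Flat.lTensor_preserves_injective_linearMap i hi
  have h : (f.rTensor P) ∘ₗ (i.lTensor N') = (i.lTensor F) ∘ₗ (f.rTensor K) := by simp
  have h' : (f.rTensor P) ∘ (i.lTensor N') = (i.lTensor F) ∘ (f.rTensor K) :=
    congrArg DFunLike.coe h
  rw [← h1.of_comp_iff, h', h2.of_comp_iff]

lemma exists_cover (R : Type) [CommRing R] (Y : Type) [AddCommGroup Y] [Module R Y] :
    ∃ (K P : Type) (_ : AddCommGroup K) (_ : AddCommGroup P) (_ : Module R K) (_ : Module R P)
      (i : K →ₗ[R] P) (p : P →ₗ[R] Y), Module.Projective R P ∧ Function.Injective i ∧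
      Function.Surjective p ∧ Function.Exact i p := by
  let p : (Y →₀ R) →ₗ[R] Y := Finsupp.linearCombination R id
  exact ⟨LinearMap.ker p, (Y →₀ R), inferInstance, inferInstance, inferInstance, inferInstance,
    (LinearMap.ker p).subtype, p, inferInstance, (LinearMap.ker p).injective_subtype,
    Finsupp.linearCombination_id_surjective R Y, LinearMap.exact_subtype_ker_map p⟩

variable [IsNoetherianRing R]

lemma TZ_shift_left {N' F N : Type} [AddCommGroup N'] [AddCommGroup F] [AddCommGroup N]
    [Module R N'] [Module R F] [Module R N] [Module.Flat R F]
    (f : N' →ₗ[R] F) (g : F →ₗ[R] N) (hf : Function.Injective f) (hg : Function.Surjective g)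
    (hfg : Function.Exact f g) (j : ℕ) : ∀ (Y : Type) [AddCommGroup Y] [Module R Y],
    TZ R (j+2) N Y ↔ TZ R (j+1) N' Y := by
  induction j with
  | zero =>
    intro Y _ _
    obtain ⟨K, P, _, _, _, _, i, p, _, hi, hp, hip⟩ := exists_cover R Y
    obtain ⟨K', P', _, _, _, _, i', p', _, hi', hp', hip'⟩ := exists_cover R K
    rw [TZ_two N i p hi hp hip, TZ_one N i' p' hi' hp' hip', TZ_one N' i p hi hp hip,
      inj_swap f hf _ hi, balance f g hf hg hfg _ p' hi' hp' hip']
  | succ j ih =>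
    intro Y _ _
    obtain ⟨K, P, _, _, _, _, i, p, _, hi, hp, hip⟩ := exists_cover R Y
    rw [TZ_two N i p hi hp hip, TZ_two N' i p hi hp hip, ih]

lemma TZ_congr {N' N : Type} [AddCommGroup N'] [AddCommGroup N]
    [Module R N'] [Module R N] (e : N ≃ₗ[R] N') (j : ℕ) (Y : Type) [AddCommGroup Y] [Module R Y] :
    TZ R j N Y ↔ TZ R j N' Y := by
  unfold TZ TorZero
  rw [← ModuleCat.isZero_iff_subsingleton, ← ModuleCat.isZero_iff_subsingleton]
  exact (((Tor (ModuleCat.{0} R) j).mapIso e.toModuleIso).app (ModuleCat.of R Y)).isZero_iff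

lemma TZ_syzygy [IsLocalRing R] (n : ℕ) : ∀ (N M : ModuleCat.{0} R), IsNthSyzygyOf R n N M →
    ∀ (j : ℕ) (Y : Type) [AddCommGroup Y] [Module R Y],
    TZ R (j+1+n) N Y ↔ TZ R (j+1) M Y := by
  induction n with
  | zero =>
    intro N M h j Y _ _
    obtain ⟨e⟩ := h
    exact TZ_congr e.symm _ _
  | succ n ih =>
    intro N M h j Y _ _
    obtain ⟨K, ⟨q, g, hg, -, ⟨e⟩⟩, hK⟩ := h
    rw [← ih K M hK j Y, TZ_congr e]
    rw [show j + 1 + (n+1) = (j+n) + 2 by ring, show j + 1 + n = (j+n)+1 by ring]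
    exact TZ_shift_left (LinearMap.ker g).subtype g (LinearMap.ker g).injective_subtype hg
      (LinearMap.exact_subtype_ker_map g) _ _

lemma finite_syzygy [IsLocalRing R] (n : ℕ) : ∀ (N M : ModuleCat.{0} R), Module.Finite R N →
    IsNthSyzygyOf R n N M → Module.Finite R M := by
  induction n with
  | zero =>
    intro N M hN h
    obtain ⟨e⟩ := h
    exact Module.Finite.equiv e.symm
  | succ n ih =>
    intro N M hN h
    obtain ⟨K, ⟨q, g, hg, -, ⟨e⟩⟩, hK⟩ := h
    exact ih K M (Module.Finite.equiv e.symm) hK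

end PartB3

section PartC1
open scoped TensorProduct
variable {R : Type} [CommRing R]

lemma tensor_nakayama [IsLocalRing R] (M W : Type) [AddCommGroup M] [Module R M]
    [AddCommGroup W] [Module R W] [Module.Finite R M] [Nontrivial M] [Module.Finite R W]
    (h : Subsingleton (M ⊗[R] W)) : Subsingleton W := by
  obtain ⟨S, hS⟩ := IsCoatomic.exists_coatom (Submodule R M)
  have hs : IsSimpleModule R (M ⧸ S) := isSimpleModule_iff_isCoatom.2 hS
  obtain ⟨I, hI, ⟨e⟩⟩ := isSimpleModule_iff_quot_maximal.1 hs
  have hIm := IsLocalRing.eq_maximalIdeal hI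
  subst hIm
  let f : M →ₗ[R] ResidueField R := e.toLinearMap ∘ₗ S.mkQ
  have hf : Function.Surjective f := e.surjective.comp S.mkQ_surjective
  rw [← IsLocalRing.subsingleton_tensorProduct (R := R)]
  exact (LinearMap.rTensor_surjective W hf).subsingleton

/-- boundaries -/
def Bd {C : ℕ → Type} [∀ i, AddCommGroup (C i)] [∀ i, Module R (C i)]
    (δ : ∀ i, C i →ₗ[R] C (i+1)) : ∀ i, Submodule R (C i)
  | 0 => ⊥
  | i+1 => LinearMap.range (δ i)

variable [IsNoetherianRing R] [IsLocalRing R]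

lemma core (N M : ModuleCat.{0} R) (n : ℕ) (hM : IsNthSyzygyOf R n N M)
    (hrig : NTorRigid R (n + 1) N) [Module.Finite R M] [Nontrivial M]
    (C : ℕ → Type) [∀ i, AddCommGroup (C i)] [∀ i, Module R (C i)]
    [∀ i, Module.Finite R (C i)] [∀ i, Module.Projective R (C i)]
    (δ : ∀ i, C i →ₗ[R] C (i+1)) (hδ : ∀ i x, δ (i+1) (δ i x) = 0) (m : ℕ)
    (HR : ∀ i, m < i → LinearMap.ker (δ i) = Bd δ i)
    (HM : ∀ i ≤ m + n, ∀ u : M ⊗[R] C i, (δ i).lTensor M u = 0 →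
      u ∈ LinearMap.range ((Bd δ i).subtype.lTensor M)) :
    LinearMap.ker (δ m) = Bd δ m := by
  have hB : ∀ i, Bd δ i ≤ LinearMap.ker (δ i) := by
    intro i
    rcases i with _ | i
    · exact bot_le
    · rintro _ ⟨x, rfl⟩
      exact hδ i x
  have hcomp : ∀ i, (δ i) ∘ₗ (Bd δ i).subtype = 0 := by
    intro i; ext x; exact hB i x.2
  have hcompT : ∀ i x, (δ i).lTensor M ((Bd δ i).subtype.lTensor M x) = 0 := by
    intro i x
    rw [← LinearMap.comp_apply, ← LinearMap.lTensor_comp, hcomp, LinearMap.lTensor_zero]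
    rfl
  -- the corestriction
  let ρ : ∀ i, C i →ₗ[R] Bd δ (i+1) := fun i => (δ i).rangeRestrict
  have hρ : ∀ i, Function.Surjective (ρ i) := fun i => (δ i).surjective_rangeRestrict
  have hρδ : ∀ i, (Bd δ (i+1)).subtype ∘ₗ ρ i = δ i := fun i => rfl
  have claim1 : ∀ i ≤ m + n, Function.Injective ((Bd δ (i+1)).subtype.lTensor M) := by
    intro i hi
    rw [injective_iff_map_eq_zero]
    intro x hx
    obtain ⟨y, rfl⟩ := LinearMap.lTensor_surjective M (hρ i) x
    rw [← LinearMap.comp_apply, ← LinearMap.lTensor_comp, hρδ] at hx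
    obtain ⟨z, rfl⟩ := HM i hi y hx
    rw [← LinearMap.comp_apply, ← LinearMap.lTensor_comp]
    have : (ρ i) ∘ₗ (Bd δ i).subtype = 0 := by
      ext x; exact hB i x.2
    rw [this, LinearMap.lTensor_zero]
    rfl
  have hQ1 : ∀ i ≤ m + n, TZ R 1 M (C (i+1) ⧸ Bd δ (i+1)) := by
    intro i hi
    rw [TZ_one M (Bd δ (i+1)).subtype (Bd δ (i+1)).mkQ (Submodule.injective_subtype _)
      (Submodule.mkQ_surjective _) (LinearMap.exact_subtype_mkQ _)]
    exact claim1 i hi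
  have hshift : ∀ i, m < i → ∀ j, TZ R (j+2) M (C (i+1) ⧸ Bd δ (i+1)) ↔
      TZ R (j+1) M (C i ⧸ Bd δ i) := by
    intro i hi j
    refine TZ_two M ((Bd δ i).liftQ (δ i) (hB i)) (Bd δ (i+1)).mkQ ?_
      (Submodule.mkQ_surjective _) ?_ j
    · rw [← LinearMap.ker_eq_bot]
      exact Submodule.ker_liftQ_eq_bot _ _ _ (HR i hi).le
    · rw [LinearMap.exact_iff, Submodule.ker_mkQ, Submodule.range_liftQ]
      rfl
  obtain ⟨T, hT⟩ : ∃ T : ℕ → ℕ → Prop, ∀ p i, T p i ↔ TZ R p M (C i ⧸ Bd δ i) :=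
    ⟨fun p i => TZ R p M (C i ⧸ Bd δ i), fun _ _ => Iff.rfl⟩
  have hshift' : ∀ k i j, m < i → (T (j+1+k) (i+k) ↔ T (j+1) i) := by
    intro k
    induction k with
    | zero => intro i j _; rfl
    | succ k ih =>
      intro i j hi
      rw [← ih i j hi, show j + 1 + (k+1) = (j + k) + 2 by ring,
        show j + 1 + k = (j + k) + 1 by ring, hT, hT]
      exact hshift (i+k) (by omega) (j+k)
  have hMT : ∀ j ≤ n, TZ R (j+1) M (C (m+n+1) ⧸ Bd δ (m+n+1)) := by
    intro j hj
    rw [← hT, show j + 1 = 0 + 1 + j by ring, show m + n + 1 = (m + (n - j) + 1) + j by omega,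
      hshift' _ _ _ (by omega), hT]
    exact hQ1 _ (by omega)
  have hNT : ∀ i, n + 1 ≤ i → TorZero R i N (ModuleCat.of R (C (m+n+1) ⧸ Bd δ (m+n+1))) := by
    refine hrig (ModuleCat.of R (C (m+n+1) ⧸ Bd δ (m+n+1)))
      (inferInstanceAs (Module.Finite R (C (m+n+1) ⧸ Bd δ (m+n+1)))) n ?_
    intro i hi1 hi2
    obtain ⟨j, rfl⟩ : ∃ j, i = j + 1 + n := ⟨i - n - 1, by omega⟩
    exact (TZ_syzygy n N M hM j _).2 (hMT j (by omega))
  have h2 : TZ R (n+1+1) M (C (m+n+1) ⧸ Bd δ (m+n+1)) :=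
    (TZ_syzygy n N M hM (n+1) _).1 (hNT _ (by omega))
  have h3 : TZ R 2 M (C (m+1) ⧸ Bd δ (m+1)) := by
    rw [← hT] at h2 ⊢
    rw [show n + 1 + 1 = 1 + 1 + n by ring, show m + n + 1 = m + 1 + n by ring,
      hshift' _ _ _ (by omega)] at h2
    exact h2
  rw [TZ_two M (Bd δ (m+1)).subtype (Bd δ (m+1)).mkQ (Submodule.injective_subtype _)
      (Submodule.mkQ_surjective _) (LinearMap.exact_subtype_mkQ _)] at h3
  have hker : LinearMap.ker (ρ m) = LinearMap.ker (δ m) := LinearMap.ker_rangeRestrict (δ m)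
  have hex : Function.Exact (LinearMap.ker (δ m)).subtype (ρ m) := by
    rw [LinearMap.exact_iff, Submodule.range_subtype, hker]
  rw [TZ_one M (LinearMap.ker (δ m)).subtype (ρ m) (Submodule.injective_subtype _) (hρ m) hex]
    at h3
  let ι := Submodule.inclusion (hB m)
  have hι : (LinearMap.ker (δ m)).subtype ∘ₗ ι = (Bd δ m).subtype := rfl
  have hsurj : Function.Surjective (ι.lTensor M) := by
    intro x
    obtain ⟨b, hb⟩ := HM m (by omega) ((LinearMap.ker (δ m)).subtype.lTensor M x) (by
      rw [← LinearMap.comp_apply, ← LinearMap.lTensor_comp, LinearMap.comp_ker_subtype,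
        LinearMap.lTensor_zero]
      rfl)
    refine ⟨b, h3 ?_⟩
    rw [← hb, ← hι, LinearMap.lTensor_comp]
    rfl
  have hex2 := lTensor_exact M (LinearMap.exact_map_mkQ_range ι) (Submodule.mkQ_surjective _)
  have hsub : Subsingleton (M ⊗[R] (LinearMap.ker (δ m) ⧸ LinearMap.range ι)) := by
    refine subsingleton_of_forall_eq 0 fun x => ?_
    obtain ⟨y, rfl⟩ := LinearMap.lTensor_surjective M (Submodule.mkQ_surjective _) x
    obtain ⟨z, rfl⟩ := hsurj y
    exact hex2.apply_apply_eq_zero z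
  have hs := tensor_nakayama _ _ hsub
  rw [Submodule.Quotient.subsingleton_iff, Submodule.range_inclusion] at hs
  refine le_antisymm (fun x hx => ?_) (hB m)
  have : (⟨x, hx⟩ : LinearMap.ker (δ m)) ∈ Submodule.comap (LinearMap.ker (δ m)).subtype (Bd δ m) := by
    rw [hs]; trivial
  exact this

end PartC1

section PartC2
open scoped TensorProduct
variable {R : Type} [CommRing R]
variable {X Y Z W : Type} [AddCommGroup X] [Module R X] [AddCommGroup Y] [Module R Y]
  [AddCommGroup Z] [Module R Z] [AddCommGroup W] [Module R W]

lemma EZ_proj [Module.Projective R X] (j : ℕ) : EZ R X W (j+1) := by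
  unfold EZ
  have : Projective (ModuleCat.of R X) := (IsProjective.iff_projective X).1 inferInstance
  exact Abelian.Ext.subsingleton_of_projective _ _ j

lemma EZ_one_mp (f : X →ₗ[R] Y) (g : Y →ₗ[R] Z) (h : Function.Exact f g)
    (hf : Function.Injective f) (hg : Function.Surjective g)
    (h1 : EZ R Z W 1) (u : X →ₗ[R] W) : ∃ v : Y →ₗ[R] W, v ∘ₗ f = u := by
  unfold EZ at h1
  obtain ⟨y, hy⟩ := Abelian.Ext.contravariant_sequence_exact₁ (sesC_exact f g h hf hg)
    (ModuleCat.of R W) (Abelian.Ext.mk₀ (ModuleCat.ofHom u)) (add_zero 1) (h1.elim _ _)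
  obtain ⟨v, rfl⟩ := (Abelian.Ext.mk₀_bijective _ _).2 y
  rw [Abelian.Ext.mk₀_comp_mk₀] at hy
  have := (Abelian.Ext.mk₀_bijective _ _).1 hy
  exact ⟨v.hom, congrArg ModuleCat.Hom.hom this⟩

lemma EZ_one_mpr [Module.Projective R Y] (f : X →ₗ[R] Y) (g : Y →ₗ[R] Z) (h : Function.Exact f g)
    (hf : Function.Injective f) (hg : Function.Surjective g)
    (h1 : ∀ u : X →ₗ[R] W, ∃ v : Y →ₗ[R] W, v ∘ₗ f = u) : EZ R Z W 1 := by
  have h2 : EZ R Y W 1 := EZ_proj 0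
  unfold EZ at *
  refine subsingleton_of_forall_eq 0 fun x => ?_
  have hS := sesC_exact f g h hf hg
  obtain ⟨y, rfl⟩ := Abelian.Ext.contravariant_sequence_exact₃ hS
    (ModuleCat.of R W) x (h2.elim _ _) (add_zero 1)
  obtain ⟨u, rfl⟩ := (Abelian.Ext.mk₀_bijective _ _).2 y
  obtain ⟨v, hv⟩ := h1 u.hom
  have hu : u = (sesC f g h).f ≫ ModuleCat.ofHom v := by
    apply ModuleCat.hom_ext
    exact hv.symm
  have hu' := Abelian.Ext.mk₀_comp_mk₀ (sesC f g h).f (Z := ModuleCat.of R W) (ModuleCat.ofHom v)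
  rw [hu]
  refine (congrArg (fun z => hS.extClass.comp z (add_zero 1)) hu'.symm).trans ?_
  exact hS.extClass_comp_assoc _

/-- finite modules -/
abbrev FM (R : Type) [CommRing R] := {K : ModuleCat.{0} R // Module.Finite R K}

noncomputable def rkF (K : FM R) : ℕ :=
  haveI := K.2
  (Module.Finite.exists_fin' R K.1).choose

noncomputable def piF (K : FM R) : (Fin (rkF K) → R) →ₗ[R] K.1 :=
  haveI := K.2
  (Module.Finite.exists_fin' R K.1).choose_spec.choose

lemma piF_surj (K : FM R) : Function.Surjective (piF K) :=
  haveI := K.2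
  (Module.Finite.exists_fin' R K.1).choose_spec.choose_spec

variable [IsNoetherianRing R]

noncomputable def nextK (K : FM R) : FM R :=
  ⟨ModuleCat.of R (LinearMap.ker (piF K)), inferInstanceAs (Module.Finite R (LinearMap.ker (piF K)))⟩

noncomputable def iotaF (K : FM R) : (nextK K).1 →ₗ[R] (Fin (rkF K) → R) :=
  (LinearMap.ker (piF K)).subtype

lemma iotaF_inj (K : FM R) : Function.Injective (iotaF K) := Subtype.val_injective

lemma iotaF_exact (K : FM R) : Function.Exact (iotaF K) (piF K) :=
  LinearMap.exact_subtype_ker_map _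

noncomputable def seqK (K : FM R) : ℕ → FM R
  | 0 => K
  | i+1 => nextK (seqK K i)

abbrev FF (K : FM R) (i : ℕ) : Type := Fin (rkF (seqK K i)) → R

noncomputable def dF (K : FM R) (i : ℕ) : FF K (i+1) →ₗ[R] FF K i :=
  iotaF (seqK K i) ∘ₗ piF (seqK K (i+1))

lemma dF_comp (K : FM R) (i : ℕ) : dF K i ∘ₗ dF K (i+1) = 0 := by
  refine LinearMap.ext fun y => ?_
  exact (congrArg (iotaF (seqK K i)) ((iotaF_exact (seqK K (i+1))).apply_apply_eq_zero _)).trans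
    (map_zero _)

lemma EZ_shift (K : FM R) (i j : ℕ) : EZ R K.1 W (i+j+1) ↔ EZ R (seqK K i).1 W (j+1) := by
  induction i generalizing j with
  | zero => rw [zero_add]; rfl
  | succ i ih =>
    rw [show i+1+j+1 = i + (j+1) + 1 by ring, ih]
    constructor
    · intro h
      exact EZ_left _ _ (iotaF_exact (seqK K i)) (iotaF_inj _) (piF_surj _) (EZ_proj _) h
    · intro h
      exact EZ_right _ _ (iotaF_exact (seqK K i)) (iotaF_inj _) (piF_surj _) h (EZ_proj _)

lemma factor_pi (K : FM R) (i : ℕ) (φ : FF K i →ₗ[R] W) (h : φ ∘ₗ dF K i = 0) :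
    ∃ u : (seqK K i).1 →ₗ[R] W, u ∘ₗ piF (seqK K i) = φ := by
  have hk : LinearMap.ker (piF (seqK K i)) ≤ LinearMap.ker φ := by
    intro x hx
    obtain ⟨y, hy⟩ := piF_surj (seqK K (i+1)) ⟨x, hx⟩
    have h2 := LinearMap.congr_fun h y
    have h3 : dF K i y = x := by
      change iotaF (seqK K i) (piF (seqK K (i+1)) y) = x
      rw [hy]; rfl
    rw [LinearMap.comp_apply, h3] at h2
    exact h2
  refine ⟨(LinearMap.ker (piF (seqK K i))).liftQ φ hk ∘ₗ
    ((piF (seqK K i)).quotKerEquivOfSurjective (piF_surj _)).symm.toLinearMap, ?_⟩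
  apply LinearMap.ext
  intro x
  have : ((piF (seqK K i)).quotKerEquivOfSurjective (piF_surj _)).symm (piF (seqK K i) x)
    = Submodule.Quotient.mk x := by
    rw [LinearEquiv.symm_apply_eq]; rfl
  simp [this]

lemma EZ_res_zero (K : FM R) (h : EZ R K.1 W 0) (φ : FF K 0 →ₗ[R] W) (hφ : φ ∘ₗ dF K 0 = 0) :
    φ = 0 := by
  obtain ⟨u, rfl⟩ := factor_pi K 0 φ hφ
  have := EZ_zero_iff.1 h
  have hu : u = 0 := this.elim _ _
  rw [hu]; rfl

lemma EZ_res_zero' (K : FM R) (h : ∀ φ : FF K 0 →ₗ[R] W, φ ∘ₗ dF K 0 = 0 → φ = 0) :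
    EZ R K.1 W 0 := by
  rw [EZ_zero_iff]
  refine subsingleton_of_forall_eq 0 fun u => ?_
  have := h (u ∘ₗ piF K) (by
    apply LinearMap.ext; intro y
    exact (congrArg u ((iotaF_exact K).apply_apply_eq_zero _)).trans (map_zero _))
  apply LinearMap.ext
  intro x
  obtain ⟨y, rfl⟩ := piF_surj K x
  exact LinearMap.congr_fun this y

lemma EZ_res_succ (K : FM R) (i : ℕ) (h : EZ R K.1 W (i+1)) (φ : FF K (i+1) →ₗ[R] W)
    (hφ : φ ∘ₗ dF K (i+1) = 0) : ∃ ψ : FF K i →ₗ[R] W, ψ ∘ₗ dF K i = φ := by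
  obtain ⟨u, rfl⟩ := factor_pi K (i+1) φ hφ
  obtain ⟨v, hv⟩ := EZ_one_mp _ _ (iotaF_exact (seqK K i)) (iotaF_inj _) (piF_surj _)
    ((EZ_shift K i 0).1 h) u
  exact ⟨v, by rw [← hv]; rfl⟩

lemma EZ_res_succ' (K : FM R) (i : ℕ) (h : ∀ φ : FF K (i+1) →ₗ[R] W,
    φ ∘ₗ dF K (i+1) = 0 → ∃ ψ : FF K i →ₗ[R] W, ψ ∘ₗ dF K i = φ) : EZ R K.1 W (i+1) := by
  refine (EZ_shift K i 0).2 (EZ_one_mpr _ _ (iotaF_exact (seqK K i)) (iotaF_inj _) (piF_surj _) ?_)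
  intro u
  obtain ⟨ψ, hψ⟩ := h (u ∘ₗ piF (seqK K (i+1))) (by
    apply LinearMap.ext; intro y
    exact (congrArg u ((iotaF_exact (seqK K (i+1))).apply_apply_eq_zero _)).trans (map_zero _))
  refine ⟨ψ, ?_⟩
  apply LinearMap.ext
  intro x
  obtain ⟨y, rfl⟩ := piF_surj (seqK K (i+1)) x
  exact LinearMap.congr_fun hψ y

end PartC2

section PartC3
open scoped TensorProduct
variable {R : Type} [CommRing R] [IsNoetherianRing R] [IsLocalRing R]

lemma final_core (N M : ModuleCat.{0} R) (n : ℕ) (hM : IsNthSyzygyOf R n N M)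
    (hrig : NTorRigid R (n + 1) N) [Module.Finite R M] [Nontrivial M]
    (K : FM R) (m : ℕ) (h1 : ∀ i, m < i → EZ R K.1 R i) (h2 : ∀ i ≤ m + n, EZ R K.1 M i) :
    EZ R K.1 R m := by
  let δ : ∀ i, Module.Dual R (FF K i) →ₗ[R] Module.Dual R (FF K (i+1)) := fun i => (dF K i).dualMap
  have hδ : ∀ i x, δ (i+1) (δ i x) = 0 := by
    intro i x
    refine LinearMap.ext fun y => ?_
    exact (congrArg x (LinearMap.congr_fun (dF_comp K i) y)).trans (map_zero x)
  have hle : ∀ i, Bd δ i ≤ LinearMap.ker (δ i) := by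
    intro i
    rcases i with _ | i
    · exact bot_le
    · rintro _ ⟨x, rfl⟩
      exact hδ i x
  have key := core N M n hM hrig (fun i => Module.Dual R (FF K i)) δ hδ m ?_ ?_
  · rcases m with _ | m
    · refine EZ_res_zero' K fun φ hφ => ?_
      have : φ ∈ LinearMap.ker (δ 0) := hφ
      rw [key] at this
      exact this
    · refine EZ_res_succ' K m fun φ hφ => ?_
      have : φ ∈ LinearMap.ker (δ (m+1)) := hφ
      rw [key] at this
      exact this
  · intro i hi
    refine le_antisymm (fun φ hφ => ?_) (hle i)
    rcases i with _ | i
    · omega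
    · exact EZ_res_succ K i (h1 _ hi) φ hφ
  · intro i hi u hu
    have nat : ∀ i (w : M ⊗[R] Module.Dual R (FF K i)),
        dualTensorHom R (FF K (i+1)) M (TensorProduct.comm R _ _ ((δ i).lTensor M w)) =
        dualTensorHom R (FF K i) M (TensorProduct.comm R _ _ w) ∘ₗ dF K i := by
      intro i w
      have := LinearMap.congr_fun (dualTensorHom_comp_rTensor_dualMap (P := M) (dF K i))
        (TensorProduct.comm R _ _ w)
      rw [LinearMap.comp_apply] at this
      rw [← LinearMap.rTensor_comm]
      exact this
    have h0 := nat i u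
    rw [hu, map_zero, map_zero] at h0
    rcases i with _ | i
    · have h3 := EZ_res_zero K (h2 0 hi) _ h0.symm
      have h4 : u = 0 := by
        apply (TensorProduct.comm R M (Module.Dual R (FF K 0))).injective
        apply (dualTensorHom_bijective (R := R) (M := FF K 0) (N := M)).1
        rw [h3, map_zero, map_zero]
      rw [h4]; exact zero_mem _
    · obtain ⟨ψ, hψ⟩ := EZ_res_succ K i (h2 _ hi) _ h0.symm
      obtain ⟨w', rfl⟩ := (dualTensorHom_bijective (R := R) (M := FF K i) (N := M)).2 ψ
      obtain ⟨w, rfl⟩ := (TensorProduct.comm R M (Module.Dual R (FF K i))).surjective w'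
      rw [← nat] at hψ
      have h4 := (TensorProduct.comm R M _).injective
        ((dualTensorHom_bijective (R := R) (M := FF K (i+1)) (N := M)).1 hψ)
      rw [← h4]
      refine ⟨(δ i).rangeRestrict.lTensor M w, ?_⟩
      exact (LinearMap.lTensor_comp_apply M (LinearMap.range (δ i)).subtype
        (δ i).rangeRestrict w).symm

open RingTheory.Sequence in
lemma edepth_attained (𝔞 : Ideal R) (M : Type) [AddCommGroup M] [Module R M] (m : ℕ)
    (hne : 𝔞 • (⊤ : Submodule R M) ≠ ⊤) (h : (m : ℕ∞) ≤ edepth R 𝔞 M) :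
    ∃ rs : List R, rs.length = m ∧ (∀ r ∈ rs, r ∈ 𝔞) ∧ IsWeaklyRegular M rs := by
  rw [edepth, if_neg hne] at h
  have : ∃ rs : List R, m ≤ rs.length ∧ (∀ r ∈ rs, r ∈ 𝔞) ∧ IsWeaklyRegular M rs := by
    rcases m with _ | m
    · exact ⟨[], by simp, by simp, IsWeaklyRegular.nil R M⟩
    · have h' : (m : ℕ∞) < _ := lt_of_lt_of_le (by exact_mod_cast m.lt_succ_self) h
      obtain ⟨_, ⟨rs, rfl, h2, h3⟩, h4⟩ := lt_sSup_iff.1 h'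
      exact ⟨rs, by exact_mod_cast h4, h2, h3.toIsWeaklyRegular⟩
  obtain ⟨rs, h1, h2, h3⟩ := this
  refine ⟨rs.take m, by simpa using h1, fun r hr => h2 r (List.mem_of_mem_take hr), ?_⟩
  rw [← List.take_append_drop m rs, isWeaklyRegular_append_iff] at h3
  exact h3.1

open RingTheory.Sequence in
lemma le_edepth (𝔞 : Ideal R) (M : Type) [AddCommGroup M] [Module R M] [Nontrivial M]
    [Module.Finite R M] (h𝔞 : 𝔞 ≤ maximalIdeal R) (rs : List R) (h1 : ∀ r ∈ rs, r ∈ 𝔞)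
    (h2 : IsWeaklyRegular M rs) : (rs.length : ℕ∞) ≤ edepth R 𝔞 M := by
  rw [edepth]
  split_ifs
  · exact le_top
  · exact le_sSup ⟨rs, rfl, h1,
      IsRegular.of_isWeaklyRegular_of_mem_maximalIdeal M (fun r hr => h𝔞 (h1 r hr)) h2⟩

lemma ne_top_of_le (𝔞 : Ideal R) (M : Type) [AddCommGroup M] [Module R M] [Nontrivial M]
    [Module.Finite R M] (h𝔞 : 𝔞 ≤ maximalIdeal R) : 𝔞 • (⊤ : Submodule R M) ≠ ⊤ := by
  intro h
  exact top_ne_bot (Submodule.eq_bot_of_le_smul_of_le_jacobson_bot 𝔞 _ Module.Finite.fg_top h.ge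
    (h𝔞.trans (IsLocalRing.maximalIdeal_le_jacobson _)))

end PartC3

/-- the depth inequality over a Gorenstein local ring for a Cohen-Macaulay
ideal `𝔞` and `M = Ω^n N` with `N` being `(n+1)`-Tor-rigid. -/
theorem depth_le_gorenstein_cm_ideal
    (R : Type) [CommRing R] [IsNoetherianRing R] [IsLocalRing R]
    (hGor : IsGorensteinLocal R)
    (N : ModuleCat.{0} R) [Module.Finite R N]
    (𝔞 : Ideal R) [IsLocalRing (R ⧸ 𝔞)]
    (hCM : (edepth (R ⧸ 𝔞) (maximalIdeal (R ⧸ 𝔞)) (R ⧸ 𝔞) : WithBot ℕ∞) =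
      ringKrullDim (R ⧸ 𝔞))
    (n : ℕ) (hn : 1 ≤ n)
    (M : ModuleCat.{0} R) (hM : IsNthSyzygyOf R n N M) [Nontrivial M]
    (hmn : (n : ℕ∞) ≤ edepth R 𝔞 R)
    (hloc : ∀ (𝔭 : Ideal R) [𝔭.IsPrime], depthLoc R 𝔭 ≤ ((n - 1 : ℕ) : ℕ∞) →
      Module.Free (Localization.AtPrime 𝔭) (LocalizedModule 𝔭.primeCompl N))
    (hrig : NTorRigid R (n + 1) N) :
    edepth R 𝔞 M ≤ edepth R 𝔞 R + n := by
  classical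
  have hloc𝔞 : 𝔞 ≤ maximalIdeal R := by
    apply IsLocalRing.le_maximalIdeal
    rintro rfl
    exact not_subsingleton (R ⧸ (⊤ : Ideal R)) inferInstance
  have hMf : Module.Finite R M := finite_syzygy n N M inferInstance hM
  by_cases htop : edepth R 𝔞 R = ⊤
  · rw [htop, top_add]; exact le_top
  obtain ⟨m, hm⟩ := ENat.ne_top_iff_exists.1 htop
  by_contra hcon
  rw [not_le, ← hm] at hcon
  have hG : ∃ d, ∀ i, d < i → EZ R (R ⧸ maximalIdeal R) R i := by
    obtain ⟨d, hd⟩ := hGor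
    refine ⟨d, fun i hi => ?_⟩
    obtain ⟨j, rfl⟩ := Nat.exists_eq_add_of_lt hi
    exact EZ_of_ExtZero _ _ (d + j) (hd _ hi)
  have hbot : ringKrullDim (R ⧸ 𝔞) ≠ ⊥ := ringKrullDim_ne_bot
  have htop' : ringKrullDim (R ⧸ 𝔞) ≠ ⊤ := ringKrullDim_ne_top
  obtain ⟨t, ht⟩ : ∃ t : ℕ, ringKrullDim (R ⧸ 𝔞) = t := by
    rw [← hCM] at htop' ⊢
    have : edepth (R ⧸ 𝔞) (maximalIdeal (R ⧸ 𝔞)) (R ⧸ 𝔞) ≠ ⊤ := by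
      intro h; rw [h] at htop'; exact htop' rfl
    obtain ⟨t, ht⟩ := ENat.ne_top_iff_exists.1 this
    exact ⟨t, by rw [← ht]; rfl⟩
  obtain ⟨rs', hl', hm', hr'⟩ := edepth_attained (maximalIdeal (R ⧸ 𝔞)) (R ⧸ 𝔞) t
    (ne_top_of_le _ _ le_rfl) (by
      rw [ht] at hCM
      exact le_of_eq (WithBot.coe_injective hCM).symm)
  obtain ⟨rs, rfl⟩ : ∃ rs : List R, rs.map (algebraMap R (R ⧸ 𝔞)) = rs' :=
    List.map_surjective_iff.2 Ideal.Quotient.mk_surjective rs'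
  rw [RingTheory.Sequence.isWeaklyRegular_map_algebraMap_iff] at hr'
  have hrsm : ∀ r ∈ rs, r ∈ maximalIdeal R := by
    intro r hr
    have := hm' _ (List.mem_map_of_mem hr)
    rw [mem_maximalIdeal, mem_nonunits_iff] at this ⊢
    exact fun h => this (h.map _)
  obtain ⟨ys, hy1, hy2, hy3⟩ := edepth_attained 𝔞 R m (ne_top_of_le _ _ hloc𝔞) hm.le
  obtain ⟨c1, c2⟩ := ext_concentrated hG 𝔞 t ht.le rs hr' hrsm (by simpa using hl') m
    ⟨ys, hy1, hy3, hy2⟩ (by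
      rintro ⟨zs, hz1, hz2, hz3⟩
      have := le_edepth 𝔞 R hloc𝔞 zs hz3 hz2
      rw [hz1, ← hm] at this
      have : m + 1 ≤ m := by exact_mod_cast this
      omega)
  obtain ⟨ws, hw1, hw2, hw3⟩ := edepth_attained 𝔞 M (m + n + 1) (ne_top_of_le _ _ hloc𝔞)
    (by have := Order.add_one_le_of_lt hcon; exact_mod_cast this)
  apply c1
  refine final_core N M n hM hrig
    (⟨ModuleCat.of R (R ⧸ 𝔞), inferInstanceAs (Module.Finite R (R ⧸ 𝔞))⟩ : FM R) m c2 ?_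
  intro i hi
  refine EZ_of_regular ws M hw3 (fun r hr => ?_) i (by omega)
  have : Module.annihilator R (R ⧸ 𝔞) = 𝔞 := Ideal.annihilator_quotient
  change r ∈ Module.annihilator R (R ⧸ 𝔞)
  rw [this]
  exact hw2 r hr
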